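/- For every f in the closure W̄, the extended operator is still given by the integral formula: Af(T,x) = ( ∫_I U(x,ξ) √( f(T,ξ)/(ξ² + f(T,ξ)) ) tanh( √(ξ² + f(T,ξ))/(2T) ) dξ )² for all (T,x) ∈ D. -/

import Mathlib

open Set MeasureTheory Filter Topology

noncomputable section

/-- The context of the BCS-Bogoliubov model: the cutoff `eps`, the Debye energy `om = ℏω_D`,
the potential `U` with bounds `U₁ ≤ U ≤ U₂`, the constant `a`, the temperatures
`tau₁, tau₂, T₀, Tc`, the solutions `Δ₁, Δ₂` of the constant-potential gap equations,
the constant `Mz = max_{z ≥ 0} z / cosh z` and the constant `MT = M_T`. -/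
structure BCSContext where
  eps : ℝ
  om : ℝ
  U : ℝ → ℝ → ℝ
  U₁ : ℝ
  U₂ : ℝ
  Umax : ℝ
  Umin : ℝ
  a : ℝ
  tau₁ : ℝ
  tau₂ : ℝ
  Δ₁ : ℝ → ℝ
  Δ₂ : ℝ → ℝ
  Tc : ℝ
  T₀ : ℝ
  Mz : ℝ
  MT : ℝ
  heps : 0 < eps
  hepsom : eps < om
  hU₁pos : 0 < U₁
  hU₁₂ : U₁ ≤ U₂
  hUsmooth : ContDiffOn ℝ 2 (fun p : ℝ × ℝ => U p.1 p.2) (Icc eps om ×ˢ Icc eps om)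
  hUlb : ∀ x ∈ Icc eps om, ∀ ξ ∈ Icc eps om, U₁ ≤ U x ξ
  hUub : ∀ x ∈ Icc eps om, ∀ ξ ∈ Icc eps om, U x ξ ≤ U₂
  hUmax : IsGreatest (Set.image2 U (Icc eps om) (Icc eps om)) Umax
  hUmin : IsLeast (Set.image2 U (Icc eps om) (Icc eps om)) Umin
  ha : a = (Umax / Umin) ^ 2
  htau₁pos : 0 < tau₁
  htau₂pos : 0 < tau₂
  htau₁ : 1 = U₁ * (∫ ξ in eps..om, Real.tanh (ξ / (2 * tau₁)) / ξ)
  htau₂ : 1 = U₂ * (∫ ξ in eps..om, Real.tanh (ξ / (2 * tau₂)) / ξ)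
  hΔ₁nonneg : ∀ T, 0 ≤ Δ₁ T
  hΔ₂nonneg : ∀ T, 0 ≤ Δ₂ T
  hΔ₁cont : Continuous Δ₁
  hΔ₂cont : Continuous Δ₂
  hΔ₁anti : StrictAntiOn Δ₁ (Icc 0 tau₁)
  hΔ₂anti : StrictAntiOn Δ₂ (Icc 0 tau₂)
  hΔ₁eq : ∀ T ∈ Ioc 0 tau₁, U₁ * (∫ ξ in eps..om,
      Real.tanh (Real.sqrt (ξ ^ 2 + Δ₁ T ^ 2) / (2 * T)) / Real.sqrt (ξ ^ 2 + Δ₁ T ^ 2)) = 1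
  hΔ₂eq : ∀ T ∈ Ioc 0 tau₂, U₂ * (∫ ξ in eps..om,
      Real.tanh (Real.sqrt (ξ ^ 2 + Δ₂ T ^ 2) / (2 * T)) / Real.sqrt (ξ ^ 2 + Δ₂ T ^ 2)) = 1
  hΔ₁zero : ∀ T, tau₁ ≤ T → Δ₁ T = 0
  hΔ₂zero : ∀ T, tau₂ ≤ T → Δ₂ T = 0
  hTc₁ : tau₁ ≤ Tc
  hTc₂ : Tc ≤ tau₂
  hT₀₁ : tau₁ < T₀
  hT₀₂ : T₀ < Tc
  hMz : IsGreatest ((fun z => z / Real.cosh z) '' Set.Ici (0 : ℝ)) Mz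
  hMT : MT = 4 * a * U₂ * Mz ^ 2 /
      (eps * U₁ *
        (Real.tanh (eps / (2 * Tc)) - (eps / (2 * Tc)) / Real.cosh (eps / (2 * Tc)) ^ 2) *
        (∫ ξ in eps..om, (ξ ^ 2 + Δ₂ 0 ^ 2) ^ (-(3 : ℝ) / 2)))

namespace BCSContext

/-- The energy interval `I = [ε, ℏω_D]`. -/
def Iset (C : BCSContext) : Set ℝ := Icc C.eps C.om

/-- The rectangle `D = [T₀, T_c] × I`. -/
def Dset (C : BCSContext) : Set (ℝ × ℝ) := Icc C.T₀ C.Tc ×ˢ Icc C.eps C.om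

end BCSContext

/-- The operator `A` of the squared BCS-Bogoliubov gap equation. -/
def opA (C : BCSContext) (f : ℝ → ℝ → ℝ) (T x : ℝ) : ℝ :=
  (∫ ξ in C.eps..C.om, C.U x ξ * Real.sqrt (f T ξ / (ξ ^ 2 + f T ξ)) *
      Real.tanh (Real.sqrt (ξ ^ 2 + f T ξ) / (2 * T))) ^ 2

/-- Partial derivative with respect to the temperature `T` (within `[T₀, T_c]`). -/
def pderivT (C : BCSContext) (g : ℝ → ℝ → ℝ) (T x : ℝ) : ℝ :=
  derivWithin (fun s => g s x) (Icc C.T₀ C.Tc) T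

/-- Partial derivative with respect to the energy `x` (within `I = [ε, ℏω_D]`). -/
def pderivX (C : BCSContext) (g : ℝ → ℝ → ℝ) (T x : ℝ) : ℝ :=
  derivWithin (fun y => g T y) (Icc C.eps C.om) x

/-- Membership in the set `W`. -/
def memW (C : BCSContext) (f : ℝ → ℝ → ℝ) : Prop :=
  ContDiffOn ℝ 2 (fun p : ℝ × ℝ => f p.1 p.2) C.Dset ∧
  (∀ T ∈ Icc C.T₀ C.Tc, ∀ x ∈ C.Iset, C.Δ₁ T ^ 2 ≤ f T x ∧ f T x ≤ C.Δ₂ T ^ 2) ∧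
  (∀ x ∈ C.Iset, f C.Tc x = 0) ∧
  (∀ T ∈ Ico C.T₀ C.Tc, ∀ x ∈ C.Iset, ∀ x₁ ∈ C.Iset, f T x ≤ C.a * f T x₁) ∧
  (∀ x ∈ C.Iset, ∀ x₁ ∈ C.Iset,
      -(pderivT C f C.Tc x) ≤ C.a * -(pderivT C f C.Tc x₁)) ∧
  (∀ T ∈ Icc C.T₀ C.Tc, ∀ x ∈ C.Iset, pderivT C f T x < 0) ∧
  (∀ T ∈ Icc C.T₀ C.Tc, ∀ x ∈ C.Iset, -(pderivT C f T x) ≤ C.MT)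

/-- The condition `a^{1/4} · max_{(T,x) ∈ D} ∫_I (U(x,ξ)/ξ) tanh(ξ/(2T)) dξ ≤ 1`. -/
def gapCondition (C : BCSContext) : Prop :=
  ∀ T ∈ Icc C.T₀ C.Tc, ∀ x ∈ C.Iset,
    C.a ^ ((1 : ℝ) / 4) * (∫ ξ in C.eps..C.om, C.U x ξ / ξ * Real.tanh (ξ / (2 * T))) ≤ 1

instance (C : BCSContext) : CompactSpace ↥C.Dset :=
  isCompact_iff_compactSpace.mp (isCompact_Icc.prod isCompact_Icc)

-- Extension of a continuous function on `D` to a function on `ℝ × ℝ` (by `0` outside `D`).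
open Classical in
def extFun (C : BCSContext) (F : C(↥C.Dset, ℝ)) : ℝ → ℝ → ℝ :=
  fun T x => if h : (T, x) ∈ C.Dset then F ⟨(T, x), h⟩ else 0

/-- The set `W` regarded as a subset of the Banach space `C(D)`. -/
def WSet (C : BCSContext) : Set C(↥C.Dset, ℝ) :=
  {F | ∃ f : ℝ → ℝ → ℝ, memW C f ∧ ∀ p : ↥C.Dset, F p = f (p : ℝ × ℝ).1 (p : ℝ × ℝ).2}

/-- The factor multiplying `U` in the integrand of `opA`, as a function of the point `(T, ξ)`
and of the value `y = f T ξ`. -/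
def gapKernel (q : (ℝ × ℝ) × ℝ) : ℝ :=
  Real.sqrt (q.2 / (q.1.2 ^ 2 + q.2)) * Real.tanh (Real.sqrt (q.1.2 ^ 2 + q.2) / (2 * q.1.1))

namespace BCSContext

theorem T₀_pos (C : BCSContext) : 0 < C.T₀ := C.htau₁pos.trans C.hT₀₁

/-- The integrand of `opA` for `f = extFun C F`. -/
def gapIntegrand (C : BCSContext) (F : C(↥C.Dset, ℝ)) (T x ξ : ℝ) : ℝ :=
  C.U x ξ * gapKernel ((T, ξ), extFun C F T ξ)

theorem opA_extFun (C : BCSContext) (F : C(↥C.Dset, ℝ)) (T x : ℝ) :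
    opA C (extFun C F) T x = (∫ ξ in C.eps..C.om, C.gapIntegrand F T x ξ) ^ 2 := by
  simp only [opA, gapIntegrand, gapKernel, mul_assoc]

theorem continuousOn_gapKernel (C : BCSContext) :
    ContinuousOn gapKernel (C.Dset ×ˢ Icc 0 (C.Δ₂ 0 ^ 2)) := by
  have tanh_cont : Continuous Real.tanh := by
    simp_rw [funext Real.tanh_eq_sinh_div_cosh]
    exact Real.continuous_sinh.div Real.continuous_cosh fun x => (Real.cosh_pos x).ne'
  unfold gapKernel
  refine ContinuousOn.mul (ContinuousOn.sqrt (ContinuousOn.div (by fun_prop) (by fun_prop) ?_))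
    (tanh_cont.comp_continuousOn (ContinuousOn.div (by fun_prop) (by fun_prop) ?_))
  · rintro ⟨⟨T, ξ⟩, y⟩ ⟨⟨-, hξ⟩, hy⟩
    have : 0 < ξ := C.heps.trans_le hξ.1
    have : 0 ≤ y := hy.1
    positivity
  · rintro ⟨⟨T, ξ⟩, y⟩ ⟨⟨hT, -⟩, -⟩
    have : 0 < T := C.T₀_pos.trans_le hT.1
    positivity

theorem isCompact_Dset_prod_Icc (C : BCSContext) :
    IsCompact (C.Dset ×ˢ Icc 0 (C.Δ₂ 0 ^ 2)) :=
  (isCompact_Icc.prod isCompact_Icc).prod isCompact_Icc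

theorem mem_Icc_of_mem_WSet (C : BCSContext) {F : C(↥C.Dset, ℝ)} (hF : F ∈ WSet C)
    (p : ↥C.Dset) : F p ∈ Icc 0 (C.Δ₂ 0 ^ 2) := by
  obtain ⟨f, hf, hFf⟩ := hF
  obtain ⟨⟨T, x⟩, hT, hx⟩ := p
  rw [hFf]
  obtain ⟨h₁, h₂⟩ := hf.2.1 T hT x hx
  have hT0 : 0 ≤ T := C.T₀_pos.le.trans hT.1
  have hle : C.Δ₂ T ≤ C.Δ₂ 0 := C.hΔ₂anti.antitoneOn ⟨le_rfl, C.htau₂pos.le⟩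
    ⟨hT0, hT.2.trans C.hTc₂⟩ hT0
  exact ⟨(sq_nonneg _).trans h₁, h₂.trans (pow_le_pow_left₀ (C.hΔ₂nonneg T) hle 2)⟩

theorem mem_Icc_of_mem_closure_WSet (C : BCSContext) {F : C(↥C.Dset, ℝ)}
    (hF : F ∈ closure (WSet C)) (p : ↥C.Dset) : F p ∈ Icc 0 (C.Δ₂ 0 ^ 2) := by
  have hclosed : IsClosed {G : C(↥C.Dset, ℝ) | G p ∈ Icc 0 (C.Δ₂ 0 ^ 2)} :=
    isClosed_Icc.preimage (continuous_eval_const p)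
  exact closure_minimal (fun G hG => C.mem_Icc_of_mem_WSet hG p) hclosed hF

theorem extFun_apply (C : BCSContext) (F : C(↥C.Dset, ℝ)) {T x : ℝ} (h : (T, x) ∈ C.Dset) :
    extFun C F T x = F ⟨(T, x), h⟩ := dif_pos h

theorem intervalIntegrable_gapIntegrand (C : BCSContext) {F : C(↥C.Dset, ℝ)}
    (hF : ∀ p, F p ∈ Icc 0 (C.Δ₂ 0 ^ 2)) {T x : ℝ} (hp : (T, x) ∈ C.Dset) :
    IntervalIntegrable (C.gapIntegrand F T x) volume C.eps C.om := by
  obtain ⟨hT, hx⟩ : T ∈ Icc C.T₀ C.Tc ∧ x ∈ Icc C.eps C.om := hp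
  apply ContinuousOn.intervalIntegrable
  rw [uIcc_of_le C.hepsom.le]
  have hU : ContinuousOn (fun ξ => C.U x ξ) (Icc C.eps C.om) :=
    C.hUsmooth.continuousOn.comp (f := fun ξ => (x, ξ)) (by fun_prop) fun ξ hξ => ⟨hx, hξ⟩
  have hext : ContinuousOn (fun ξ => extFun C F T ξ) (Icc C.eps C.om) := by
    rw [continuousOn_iff_continuous_domRestrict]
    have : (Icc C.eps C.om).domRestrict (fun ξ => extFun C F T ξ) =
        fun ξ => F ⟨(T, ξ.1), hT, ξ.2⟩ := funext fun ξ => C.extFun_apply F ⟨hT, ξ.2⟩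
    rw [this]
    fun_prop
  refine hU.mul (C.continuousOn_gapKernel.comp (ContinuousOn.prodMk (by fun_prop) hext) ?_)
  intro ξ hξ
  have hq : (T, ξ) ∈ C.Dset := ⟨hT, hξ⟩
  refine ⟨hq, ?_⟩
  change extFun C F T ξ ∈ _
  rw [C.extFun_apply F hq]
  exact hF _

/-- If a function is at most `c` in absolute value on `I`, its product with `U x` integrates to at
most `U₂ * c * (om - eps)`. -/
theorem abs_integral_U_mul_le (C : BCSContext) {x c : ℝ} {k : ℝ → ℝ} (hx : x ∈ Icc C.eps C.om)
    (hk : ∀ ξ ∈ Icc C.eps C.om, |k ξ| ≤ c) :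
    |∫ ξ in C.eps..C.om, C.U x ξ * k ξ| ≤ C.U₂ * c * (C.om - C.eps) := by
  rw [← abs_of_pos (sub_pos.2 C.hepsom), ← Real.norm_eq_abs]
  refine intervalIntegral.norm_integral_le_of_norm_le_const fun ξ hξ => ?_
  rw [uIoc_of_le C.hepsom.le] at hξ
  have hξ' := Ioc_subset_Icc_self hξ
  have hU : 0 ≤ C.U x ξ := C.hU₁pos.le.trans (C.hUlb x hx ξ hξ')
  rw [norm_mul, Real.norm_of_nonneg hU]
  exact mul_le_mul (C.hUub x hx ξ hξ') (hk ξ hξ') (norm_nonneg _)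
    (hU.trans (C.hUub x hx ξ hξ'))

theorem tendstoUniformlyOn_integral (C : BCSContext) {F : C(↥C.Dset, ℝ)}
    {g : ℕ → C(↥C.Dset, ℝ)} (hF : ∀ p, F p ∈ Icc 0 (C.Δ₂ 0 ^ 2))
    (hg : ∀ n p, g n p ∈ Icc 0 (C.Δ₂ 0 ^ 2)) (hlim : Tendsto g atTop (𝓝 F)) :
    TendstoUniformlyOn (fun n (p : ℝ × ℝ) => ∫ ξ in C.eps..C.om, C.gapIntegrand (g n) p.1 p.2 ξ)
      (fun p : ℝ × ℝ => ∫ ξ in C.eps..C.om, C.gapIntegrand F p.1 p.2 ξ) atTop C.Dset := by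
  rw [Metric.tendstoUniformlyOn_iff]
  intro r hr
  have hB : 0 < C.U₂ * (C.om - C.eps) :=
    mul_pos (C.hU₁pos.trans_le C.hU₁₂) (sub_pos.2 C.hepsom)
  obtain ⟨δ, hδ, huc⟩ := Metric.uniformContinuousOn_iff.1
    (C.isCompact_Dset_prod_Icc.uniformContinuousOn_of_continuous C.continuousOn_gapKernel)
    (r / (2 * (C.U₂ * (C.om - C.eps)))) (by positivity)
  filter_upwards [Metric.tendsto_nhds.1 hlim δ hδ] with n hn
  rintro ⟨T, x⟩ hp
  rw [Real.dist_eq, ← intervalIntegral.integral_sub (C.intervalIntegrable_gapIntegrand hF hp)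
    (C.intervalIntegrable_gapIntegrand (hg n) hp)]
  simp only [gapIntegrand, ← mul_sub]
  refine (C.abs_integral_U_mul_le hp.2 fun ξ hξ => ?_).trans_lt
    (b := C.U₂ * (r / (2 * (C.U₂ * (C.om - C.eps)))) * (C.om - C.eps)) ?_
  · have hq : (T, ξ) ∈ C.Dset := ⟨hp.1, hξ⟩
    rw [C.extFun_apply F hq, C.extFun_apply (g n) hq, ← Real.dist_eq]
    refine (huc _ ⟨hq, hF _⟩ _ ⟨hq, hg n _⟩ ?_).le
    rw [dist_prod_same_left, dist_comm]
    exact (ContinuousMap.dist_apply_le_dist _).trans_lt hn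
  · calc C.U₂ * (r / (2 * (C.U₂ * (C.om - C.eps)))) * (C.om - C.eps)
        = (C.U₂ * (C.om - C.eps)) * (r / (2 * (C.U₂ * (C.om - C.eps)))) := by ring
      _ = r / 2 := by rw [← div_div, mul_div_cancel₀ _ hB.ne']
      _ < r := half_lt_self hr

theorem exists_abs_integral_gapIntegrand_le (C : BCSContext) :
    ∃ B, ∀ F : C(↥C.Dset, ℝ), (∀ p, F p ∈ Icc 0 (C.Δ₂ 0 ^ 2)) → ∀ p ∈ C.Dset,
      |∫ ξ in C.eps..C.om, C.gapIntegrand F p.1 p.2 ξ| ≤ B := by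
  obtain ⟨c, hc⟩ := C.isCompact_Dset_prod_Icc.exists_bound_of_continuousOn C.continuousOn_gapKernel
  refine ⟨C.U₂ * c * (C.om - C.eps), fun F hF p hp => C.abs_integral_U_mul_le hp.2 fun ξ hξ => ?_⟩
  have hq : (p.1, ξ) ∈ C.Dset := ⟨hp.1, hξ⟩
  rw [C.extFun_apply F hq]
  exact hc _ ⟨hq, hF _⟩

end BCSContext

theorem stmt_16 (C : BCSContext) (hcond : gapCondition C) :
    ∀ F ∈ closure (WSet C),
      ∀ g : ℕ → C(↥C.Dset, ℝ), (∀ n, g n ∈ WSet C) → Tendsto g atTop (𝓝 F) →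
        TendstoUniformlyOn (fun n (p : ℝ × ℝ) => opA C (extFun C (g n)) p.1 p.2)
          (fun p : ℝ × ℝ => opA C (extFun C F) p.1 p.2) atTop C.Dset := by
  intro F hF g hg hlim
  have hF' := C.mem_Icc_of_mem_closure_WSet hF
  have hg' := fun n => C.mem_Icc_of_mem_WSet (hg n)
  obtain ⟨B, hB⟩ := C.exists_abs_integral_gapIntegrand_le
  simp only [C.opA_extFun]
  rw [tendstoUniformlyOn_iff_tendstoUniformly_comp_coe]
  exact UniformContinuousOn.comp_tendstoUniformly (s := Icc (-B) B) (g := fun y : ℝ => y ^ 2)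
    (fun n p => abs_le.1 (hB _ (hg' n) p p.2)) (fun p => abs_le.1 (hB _ hF' p p.2))
    (isCompact_Icc.uniformContinuousOn_of_continuous (by fun_prop))
    (tendstoUniformlyOn_iff_tendstoUniformly_comp_coe.1
      (C.tendstoUniformlyOn_integral hF' hg' hlim))

end
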